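/- arXiv:1502.04306 — 5 statements merged into one kernel-verified Lean document; each statement's English description precedes it below -/
import Mathlib

section
/- Let w ∈ C⁴(ℝ≥0) be a real function (the known law of motion of the train) and consider the Whitney pendulum equation φ̈ = sin φ − ẅ(t) cos φ. Then for every λ ∈ ℝ there exists an angle ψ ∈ (−π/2, π/2) such that the initial value problem with φ(0) = ψ and φ̇(0) = λ((π/2)² − ψ²) has a solution φ ∈ C⁴(ℝ≥0) satisfying |φ(t)| < π/2 for all t ≥ 0. -/
open Set Real

noncomputable section

open scoped NNReal Topology
open Filter

/-- The vector field on phase space of `φ̈ = sin φ - a(t) cos φ`. -/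
def pendulumField (a : ℝ → ℝ) (t : ℝ) (p : ℝ × ℝ) : ℝ × ℝ :=
  (p.2, sin p.1 - a t * cos p.1)

lemma abs_sin_sub_mul_cos_le {a M : ℝ} (ha : |a| ≤ M) (x : ℝ) :
    |sin x - a * cos x| ≤ 1 + M := by
  have h : |a * cos x| ≤ M := by
    rw [abs_mul]
    exact (mul_le_of_le_one_right (abs_nonneg a) (abs_cos_le_one x)).trans ha
  exact (abs_sub _ _).trans (add_le_add (abs_sin_le_one x) h)

lemma lipschitzWith_pendulumField {a : ℝ → ℝ} {t : ℝ} {M : ℝ≥0} (ha : |a t| ≤ M) :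
    LipschitzWith (1 + M) (pendulumField a t) := by
  refine LipschitzWith.of_dist_le_mul fun p q ↦ ?_
  have hM : (0 : ℝ) ≤ M := M.2
  have hd := dist_nonneg (x := p) (y := q)
  have h₁ : |p.1 - q.1| ≤ dist p q := le_max_left _ _
  have h₂ : |p.2 - q.2| ≤ dist p q := le_max_right _ _
  have hs : |sin p.1 - sin q.1| ≤ |p.1 - q.1| := by
    simpa [Real.dist_eq] using lipschitzWith_sin.dist_le_mul p.1 q.1
  have hc : |cos p.1 - cos q.1| ≤ |p.1 - q.1| := by
    simpa [Real.dist_eq] using lipschitzWith_cos.dist_le_mul p.1 q.1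
  refine max_le ?_ ?_
  · simp only [pendulumField, Real.dist_eq, NNReal.coe_add, NNReal.coe_one]
    nlinarith
  · simp only [pendulumField, Real.dist_eq, NNReal.coe_add, NNReal.coe_one]
    calc |sin p.1 - a t * cos p.1 - (sin q.1 - a t * cos q.1)|
        = |(sin p.1 - sin q.1) - a t * (cos p.1 - cos q.1)| := by ring_nf
      _ ≤ |sin p.1 - sin q.1| + |a t| * |cos p.1 - cos q.1| := by
        rw [← abs_mul]; exact abs_sub _ _
      _ ≤ dist p q + M * dist p q := by gcongr <;> linarith
      _ = (1 + M) * dist p q := by ring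

lemma exists_nnreal_bound_of_continuousOn {a : ℝ → ℝ} (ha : ContinuousOn a (Ici 0)) (T : ℝ) :
    ∃ M : ℝ≥0, ∀ t ∈ Icc 0 T, |a t| ≤ M := by
  obtain ⟨C, hC⟩ := isCompact_Icc.exists_bound_of_continuousOn
    (ha.mono (Icc_subset_Ici_self : Icc 0 T ⊆ Ici 0))
  exact ⟨C.toNNReal, fun t ht ↦ (hC t ht).trans (Real.le_coe_toNNReal C)⟩

/-- Solutions exist on every compact interval: truncating the velocity makes the field bounded,
and the velocity of a solution cannot reach the truncation threshold. -/
lemma exists_isIntegralCurveOn_pendulumField_Icc {a : ℝ → ℝ} (ha : ContinuousOn a (Ici 0))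
    {T : ℝ} (hT : 0 ≤ T) (p : ℝ × ℝ) :
    ∃ γ : ℝ → ℝ × ℝ, γ 0 = p ∧ IsIntegralCurveOn γ (pendulumField a) (Icc 0 T) := by
  obtain ⟨M, hM⟩ := exists_nnreal_bound_of_continuousOn ha T
  lift T to ℝ≥0 using hT
  set R : ℝ≥0 := ‖p.2‖₊ + (1 + M) * T with hR
  have hR_nonneg : (0 : ℝ) ≤ R := R.2
  let c : ℝ × ℝ → ℝ × ℝ := fun q ↦ (q.1, max (-(R : ℝ)) (min R q.2))
  have hc : LipschitzWith 1 c := by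
    simpa using LipschitzWith.prod_fst.prodMk
      ((LipschitzWith.prod_snd.const_min (R : ℝ)).const_max (-(R : ℝ)))
  have hpl : IsPicardLindelof (fun t q ↦ pendulumField a t (c q))
      (⟨0, left_mem_Icc.2 T.2⟩ : Icc (0 : ℝ) T) p ((R + (1 + M)) * T) 0 (R + (1 + M)) (1 + M) := by
    refine ⟨fun t ht ↦ ?_, fun q _ ↦ ?_, fun t ht q _ ↦ ?_, ?_⟩
    · have h := (lipschitzWith_pendulumField (hM t ht)).comp hc
      rw [mul_one] at h
      exact h.lipschitzOnWith
    · have := ha.mono (Icc_subset_Ici_self : Icc 0 (T : ℝ) ⊆ Ici 0)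
      simp only [pendulumField]
      fun_prop
    · have h := abs_sin_sub_mul_cos_le (hM t ht) q.1
      have hM0 : (0 : ℝ) ≤ M := M.2
      refine max_le ?_ ?_
      · simp only [pendulumField, c, Real.norm_eq_abs, NNReal.coe_add, NNReal.coe_one]
        rw [abs_le]
        constructor
        · linarith [le_max_left (-(R : ℝ)) (min R q.2)]
        · linarith [max_le (by linarith : -(R : ℝ) ≤ R) (min_le_left (R : ℝ) q.2)]
      · simp only [pendulumField, c, Real.norm_eq_abs, NNReal.coe_add, NNReal.coe_one]
        linarith
    · simp
  obtain ⟨γ, h0, hγ⟩ := hpl.exists_eq_forall_mem_Icc_hasDerivWithinAt₀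
  refine ⟨γ, h0, fun t ht ↦ ?_⟩
  have hbound : ‖(γ t).2 - (γ 0).2‖ ≤ (1 + M) * ‖t - 0‖ :=
    (convex_Icc (0 : ℝ) T).norm_image_sub_le_of_norm_hasDerivWithin_le
      (f := fun s ↦ (γ s).2) (fun s hs ↦ (hγ s hs).snd)
      (fun s hs ↦ abs_sin_sub_mul_cos_le (hM s hs) (γ s).1) (left_mem_Icc.2 T.2) ht
  have hR' : |(γ t).2| ≤ R := by
    have h0' : γ 0 = p := h0
    rw [h0', sub_zero, Real.norm_eq_abs, Real.norm_of_nonneg ht.1] at hbound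
    have h₁ : |(γ t).2| ≤ |p.2| + |(γ t).2 - p.2| := by
      simpa using abs_add_le p.2 ((γ t).2 - p.2)
    have h₂ : (1 + M : ℝ) * t ≤ (1 + M) * T := by gcongr; exact ht.2
    simp only [hR, NNReal.coe_add, NNReal.coe_mul, NNReal.coe_one, coe_nnnorm, Real.norm_eq_abs]
    linarith
  have hct : c (γ t) = γ t := by
    simp only [c, min_eq_right (abs_le.1 hR').2, max_eq_right (abs_le.1 hR').1]
  simpa only [hct] using hγ t ht

lemma exists_dist_le_mul_of_isIntegralCurveOn_pendulumField {a : ℝ → ℝ}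
    (ha : ContinuousOn a (Ici 0)) (T : ℝ) :
    ∃ C : ℝ, ∀ γ₁ γ₂ : ℝ → ℝ × ℝ, IsIntegralCurveOn γ₁ (pendulumField a) (Icc 0 T) →
      IsIntegralCurveOn γ₂ (pendulumField a) (Icc 0 T) →
      ∀ t ∈ Icc 0 T, dist (γ₁ t) (γ₂ t) ≤ dist (γ₁ 0) (γ₂ 0) * C := by
  obtain ⟨M, hM⟩ := exists_nnreal_bound_of_continuousOn ha T
  refine ⟨exp ((1 + M : ℝ≥0) * (T - 0)), fun γ₁ γ₂ h₁ h₂ t ht ↦ ?_⟩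
  have right {γ : ℝ → ℝ × ℝ} (h : IsIntegralCurveOn γ (pendulumField a) (Icc 0 T)) :
      ∀ s ∈ Ico 0 T, HasDerivWithinAt γ (pendulumField a s (γ s)) (Ici s) s := fun s hs ↦
    (h s (Ico_subset_Icc_self hs)).mono_of_mem_nhdsWithin
      (mem_of_superset (Icc_mem_nhdsGE hs.2) (Icc_subset_Icc_left hs.1))
  refine (dist_le_of_trajectories_ODE_of_mem (s := fun _ ↦ univ)
    (fun s hs ↦ (lipschitzWith_pendulumField (hM s (Ico_subset_Icc_self hs))).lipschitzOnWith)
    h₁.continuousOn (right h₁) (fun _ _ ↦ trivial) h₂.continuousOn (right h₂)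
    (fun _ _ ↦ trivial) le_rfl t ht).trans ?_
  gcongr
  exact ht.2

lemma exists_isIntegralCurveOn_pendulumField_Ici {a : ℝ → ℝ} (ha : ContinuousOn a (Ici 0))
    (p : ℝ × ℝ) :
    ∃ γ : ℝ → ℝ × ℝ, γ 0 = p ∧ IsIntegralCurveOn γ (pendulumField a) (Ici 0) := by
  choose γ h0 hγ using fun n : ℕ ↦
    exists_isIntegralCurveOn_pendulumField_Icc ha n.cast_nonneg p
  have unique {m n : ℕ} {t : ℝ} (ht : 0 ≤ t) (hm : t ≤ m) (hn : t ≤ n) : γ m t = γ n t := by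
    obtain ⟨C, hC⟩ := exists_dist_le_mul_of_isIntegralCurveOn_pendulumField ha t
    have := hC (γ m) (γ n) ((hγ m).mono (Icc_subset_Icc_right hm))
      ((hγ n).mono (Icc_subset_Icc_right hn)) t ⟨ht, le_rfl⟩
    rw [h0, h0, dist_self, zero_mul] at this
    exact dist_le_zero.1 this
  refine ⟨fun t ↦ γ ⌈t⌉₊ t, h0 _, fun t ht ↦ ?_⟩
  obtain ⟨n, hn⟩ := exists_nat_gt t
  have hmem : Icc (0 : ℝ) n ∈ 𝓝[Ici 0] t := by
    rw [← Ici_inter_Iic]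
    exact inter_mem_nhdsWithin _ (Iic_mem_nhds hn)
  have heq : ∀ s ∈ Icc (0 : ℝ) n, γ ⌈s⌉₊ s = γ n s := fun s hs ↦
    unique hs.1 (Nat.le_ceil s) hs.2
  have ht' : t ∈ Icc (0 : ℝ) n := ⟨ht, hn.le⟩
  refine HasDerivWithinAt.mono_of_mem_nhdsWithin ?_ hmem
  simp only [heq t ht']
  exact (hγ n t ht').congr heq (heq t ht')

lemma exists_strictMonoOn_Icc_of_second_deriv_pos {f f' : ℝ → ℝ} {T c : ℝ} (hT : 0 ≤ T)
    (hf : ∀ t ∈ Ici (0 : ℝ), HasDerivWithinAt f (f' t) (Ici 0) t)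
    (hf' : HasDerivWithinAt f' c (Ici 0) T) (hc : 0 < c) (h0 : 0 ≤ f' T) :
    ∃ t > T, StrictMonoOn f (Icc T t) := by
  have hslope := hasDerivWithinAt_iff_tendsto_slope' self_notMem_Ioi |>.1
    (hf'.mono (Ioi_subset_Ici hT))
  obtain ⟨t, ht, hsub⟩ := mem_nhdsGT_iff_exists_Ioo_subset.1 (hslope.eventually_const_lt hc)
  refine ⟨t, ht, strictMonoOn_of_hasDerivWithinAt_pos (f' := f') (convex_Icc T t)
    (fun s hs ↦ ((hf s (hT.trans hs.1)).continuousWithinAt).mono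
      (Icc_subset_Ici_self.trans (Ici_subset_Ici.2 hT))) (fun s hs ↦ ?_) fun s hs ↦ ?_⟩
  · rw [interior_Icc] at hs ⊢
    exact (hf s (hT.trans hs.1.le)).mono
      (Ioo_subset_Icc_self.trans (Icc_subset_Ici_self.trans (Ici_subset_Ici.2 hT)))
  · rw [interior_Icc] at hs
    have h : 0 < slope f' T s := hsub hs
    rw [slope_def_field, div_pos_iff_of_pos_right (sub_pos.2 hs.1)] at h
    linarith

lemma nonneg_of_hasDerivWithinAt_of_forall_lt {f : ℝ → ℝ} {d T : ℝ} (hT : 0 < T)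
    (hf : HasDerivWithinAt f d (Ici 0) T) (hlt : ∀ s ∈ Ico 0 T, f s < f T) : 0 ≤ d := by
  have hslope := hasDerivWithinAt_iff_tendsto_slope' right_notMem_Ico |>.1
    (hf.mono (Ico_subset_Icc_self.trans Icc_subset_Ici_self : Ico 0 T ⊆ Ici 0))
  rw [nhdsWithin_Ico_eq_nhdsLT hT] at hslope
  refine ge_of_tendsto hslope ?_
  filter_upwards [Ico_mem_nhdsLT hT] with s hs
  rw [slope_def_field]
  exact div_nonneg_of_nonpos (sub_nonpos.2 (hlt s hs).le) (sub_nonpos.2 hs.2.le)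

lemma exists_first_hitting_time {g : ℝ → ℝ} {c t : ℝ} (hg : ContinuousOn g (Ici 0))
    (h0 : g 0 ≤ c) (ht : 0 ≤ t) (hct : c ≤ g t) :
    ∃ T ∈ Ici (0 : ℝ), g T = c ∧ ∀ s ∈ Ico 0 T, g s < c := by
  have hcont (s : ℝ) : ContinuousOn g (Icc 0 s) := hg.mono Icc_subset_Ici_self
  have hcomp : IsCompact (Icc 0 t ∩ g ⁻¹' {c}) :=
    isCompact_Icc.of_isClosed_subset
      ((hcont t).preimage_isClosed_of_isClosed isClosed_Icc isClosed_singleton) inter_subset_left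
  obtain ⟨T, hT, hleast⟩ := hcomp.exists_isLeast
    (by obtain ⟨s, hs, h⟩ := intermediate_value_Icc ht (hcont t) ⟨h0, hct⟩; exact ⟨s, hs, h⟩)
  refine ⟨T, hT.1.1, hT.2, fun s hs ↦ ?_⟩
  by_contra! hcs
  obtain ⟨r, hr, h⟩ := intermediate_value_Icc hs.1 (hcont s) ⟨h0, hcs⟩
  have : T ≤ r := hleast ⟨⟨hr.1, hr.2.trans (hs.2.le.trans hT.1.2)⟩, h⟩
  linarith [hr.2, hs.2]

/-- `f` exceeds the level `c` before leaving `(-c, ∞)`. -/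
def ExitsAbove (c : ℝ) (f : ℝ → ℝ) : Prop :=
  ∃ t ∈ Ici (0 : ℝ), c < f t ∧ ∀ s ∈ Icc 0 t, -c < f s

lemma isOpen_setOf_exitsAbove {x : ℝ → ℝ → ℝ} (c : ℝ)
    (hcont : ∀ ψ, ContinuousOn (x ψ) (Ici 0))
    (hx : ∀ ψ₀ T, ∀ ε > 0, ∀ᶠ ψ in 𝓝 ψ₀, ∀ s ∈ Icc 0 T, |x ψ s - x ψ₀ s| < ε) :
    IsOpen {ψ | ExitsAbove c (x ψ)} := by
  refine isOpen_iff_mem_nhds.2 fun ψ₀ ⟨t, ht, htc, hs⟩ ↦ ?_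
  obtain ⟨r, hr, hmin⟩ := isCompact_Icc.exists_isMinOn (nonempty_Icc.2 ht)
    ((hcont ψ₀).mono (Icc_subset_Ici_self : Icc 0 t ⊆ Ici 0))
  filter_upwards [hx ψ₀ t (min (x ψ₀ t - c) (x ψ₀ r + c))
    (lt_min (sub_pos.2 htc) (by linarith [hs r hr]))] with ψ hψ
  refine ⟨t, ht, ?_, fun s hs' ↦ ?_⟩
  · have := (abs_lt.1 ((hψ t ⟨ht, le_rfl⟩).trans_le (min_le_left _ _))).1
    linarith
  · have := (abs_lt.1 ((hψ s hs').trans_le (min_le_right _ _))).1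
    have := isMinOn_iff.1 hmin s hs'
    linarith

lemma exitsAbove_of_hits {a f f' : ℝ → ℝ} {T : ℝ} (hT : 0 ≤ T)
    (hf : ∀ t ∈ Ici (0 : ℝ), HasDerivWithinAt f (f' t) (Ici 0) t ∧
      HasDerivWithinAt f' (sin (f t) - a t * cos (f t)) (Ici 0) t)
    (hfT : f T = π / 2) (hlt : ∀ s ∈ Ico 0 T, |f s| < π / 2) (h0 : T = 0 → f' 0 = 0) :
    ExitsAbove (π / 2) f := by
  have hpi := pi_pos
  have hnonneg : 0 ≤ f' T := by
    rcases hT.eq_or_lt with rfl | hT'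
    · exact (h0 rfl).ge
    · exact nonneg_of_hasDerivWithinAt_of_forall_lt hT' (hf T hT).1 fun s hs ↦
        hfT ▸ (abs_lt.1 (hlt s hs)).2
  have hacc : 0 < sin (f T) - a T * cos (f T) := by simp [hfT]
  obtain ⟨t, ht, hmono⟩ := exists_strictMonoOn_Icc_of_second_deriv_pos hT
    (fun t ht ↦ (hf t ht).1) (hf T hT).2 hacc hnonneg
  refine ⟨t, hT.trans ht.le, ?_, fun s hs ↦ ?_⟩
  · exact hfT ▸ hmono (left_mem_Icc.2 ht.le) (right_mem_Icc.2 ht.le) ht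
  · rcases lt_or_ge s T with h | h
    · exact (abs_lt.1 (hlt s ⟨hs.1, h⟩)).1
    · have := hmono.monotoneOn (left_mem_Icc.2 ht.le) ⟨h, hs.2⟩ h
      linarith

lemma neg_solution {a f f' : ℝ → ℝ}
    (hf : ∀ t ∈ Ici (0 : ℝ), HasDerivWithinAt f (f' t) (Ici 0) t ∧
      HasDerivWithinAt f' (sin (f t) - a t * cos (f t)) (Ici 0) t) :
    ∀ t ∈ Ici (0 : ℝ), HasDerivWithinAt (-f) ((-f') t) (Ici 0) t ∧
      HasDerivWithinAt (-f') (sin ((-f) t) - (-a) t * cos ((-f) t)) (Ici 0) t := by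
  refine fun t ht ↦ ⟨(hf t ht).1.neg, (hf t ht).2.neg.congr_deriv ?_⟩
  simp only [Pi.neg_apply, sin_neg, cos_neg]
  ring

lemma not_exitsAbove_and_exitsAbove_neg {c : ℝ} {f : ℝ → ℝ} :
    ¬ (ExitsAbove c f ∧ ExitsAbove c (-f)) := by
  rintro ⟨⟨t, ht, htc, hts⟩, ⟨r, hr, hrc, hrs⟩⟩
  simp only [Pi.neg_apply] at hrc hrs
  rcases le_total t r with h | h
  · linarith [hrs t ⟨ht, h⟩]
  · linarith [hts r ⟨hr, h⟩]

lemma abs_lt_of_not_exitsAbove {a f f' : ℝ → ℝ}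
    (hf : ∀ t ∈ Ici (0 : ℝ), HasDerivWithinAt f (f' t) (Ici 0) t ∧
      HasDerivWithinAt f' (sin (f t) - a t * cos (f t)) (Ici 0) t)
    (hle : |f 0| ≤ π / 2) (h0 : |f 0| = π / 2 → f' 0 = 0)
    (habove : ¬ ExitsAbove (π / 2) f) (hbelow : ¬ ExitsAbove (π / 2) (-f)) :
    ∀ t ∈ Ici (0 : ℝ), |f t| < π / 2 := by
  intro t ht
  by_contra! hge
  have hcont : ContinuousOn (fun t ↦ |f t|) (Ici 0) := fun s hs ↦
    (hf s hs).1.continuousWithinAt.abs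
  obtain ⟨T, hT, hfT, hlt⟩ := exists_first_hitting_time hcont hle ht hge
  have h0' : T = 0 → f' 0 = 0 := by rintro rfl; exact h0 hfT
  rcases eq_or_eq_neg_of_abs_eq hfT with h | h
  · exact habove (exitsAbove_of_hits hT hf h hlt h0')
  · exact hbelow (exitsAbove_of_hits hT (neg_solution hf) (by simp [h])
      (by simpa using hlt) (by simpa using h0'))

lemma contDiffOn_succ_of_hasDerivWithinAt {f f' : ℝ → ℝ} {n : ℕ}
    (hf : ∀ t ∈ Ici (0 : ℝ), HasDerivWithinAt f (f' t) (Ici 0) t)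
    (hf' : ContDiffOn ℝ n f' (Ici 0)) : ContDiffOn ℝ (n + 1) f (Ici 0) := by
  refine (contDiffOn_succ_iff_derivWithin (uniqueDiffOn_Ici 0)).2
    ⟨fun t ht ↦ (hf t ht).differentiableWithinAt, by simp, hf'.congr fun t ht ↦ ?_⟩
  exact (hf t ht).derivWithin (uniqueDiffOn_Ici 0 t ht)

lemma contDiffOn_four_of_solution {a f f' : ℝ → ℝ} (ha : ContDiffOn ℝ 2 a (Ici 0))
    (hf : ∀ t ∈ Ici (0 : ℝ), HasDerivWithinAt f (f' t) (Ici 0) t ∧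
      HasDerivWithinAt f' (sin (f t) - a t * cos (f t)) (Ici 0) t) :
    ContDiffOn ℝ 4 f (Ici 0) := by
  have gain {n : ℕ} (hn : n ≤ 2) (h : ContDiffOn ℝ n f (Ici 0)) :
      ContDiffOn ℝ (n + 2 : ℕ) f (Ici 0) := by
    have ha' : ContDiffOn ℝ n a (Ici 0) := ha.of_le (by exact_mod_cast hn)
    have h₁ := contDiffOn_succ_of_hasDerivWithinAt (fun t ht ↦ (hf t ht).2)
      (h.sin.sub (ha'.mul h.cos))
    exact_mod_cast contDiffOn_succ_of_hasDerivWithinAt (n := n + 1) (fun t ht ↦ (hf t ht).1)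
      (by exact_mod_cast h₁)
  have h0 : ContDiffOn ℝ (0 : ℕ) f (Ici 0) := by
    have hcont : ContinuousOn f (Ici 0) := fun t ht ↦ (hf t ht).1.continuousWithinAt
    exact_mod_cast contDiffOn_zero.2 hcont
  exact_mod_cast gain le_rfl (gain zero_le_two h0)

/-- For the Whitney pendulum `φ̈ = sin φ − ẅ(t) cos φ` with `w ∈ C⁴(ℝ≥0)`, for every
`λ ∈ ℝ` there is an initial angle `ψ ∈ (−π/2, π/2)` such that the solution with
`φ(0) = ψ`, `φ̇(0) = λ((π/2)² − ψ²)` is defined for all `t ≥ 0` and never falls: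
`|φ(t)| < π/2` for all `t ≥ 0`. -/
theorem whitney_pendulum_never_falls (w : ℝ → ℝ) (hw : ContDiffOn ℝ 4 w (Ici 0)) (lam : ℝ) :
    ∃ ψ ∈ Ioo (-(π/2)) (π/2), ∃ φ φ' : ℝ → ℝ,
      (∀ t ∈ Ici (0:ℝ), HasDerivWithinAt φ (φ' t) (Ici 0) t ∧
        HasDerivWithinAt φ'
          (Real.sin (φ t) - iteratedDerivWithin 2 w (Ici 0) t * Real.cos (φ t)) (Ici 0) t) ∧
      ContDiffOn ℝ 4 φ (Ici 0) ∧
      φ 0 = ψ ∧ φ' 0 = lam * ((π/2)^2 - ψ^2) ∧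
      ∀ t ∈ Ici (0:ℝ), |φ t| < π/2 := by
  set a := iteratedDerivWithin 2 w (Ici 0) with ha_def
  have ha : ContDiffOn ℝ 2 a (Ici 0) := by
    have : a = derivWithin (derivWithin w (Ici 0)) (Ici 0) := by
      ext t
      rw [ha_def, iteratedDerivWithin_succ, iteratedDerivWithin_one]
    rw [this]
    have hu := uniqueDiffOn_Ici (0 : ℝ)
    exact (hw.derivWithin (m := 3) hu (by norm_num)).derivWithin hu (by norm_num)
  let start : ℝ → ℝ × ℝ := fun ψ ↦ (ψ, lam * ((π / 2) ^ 2 - ψ ^ 2))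
  have hstart : Continuous start := by fun_prop
  choose γ h0 hγ using fun ψ ↦ exists_isIntegralCurveOn_pendulumField_Ici ha.continuousOn (start ψ)
  let x : ℝ → ℝ → ℝ := fun ψ t ↦ (γ ψ t).1
  let y : ℝ → ℝ → ℝ := fun ψ t ↦ (γ ψ t).2
  have hx0 (ψ) : x ψ 0 = ψ := congrArg Prod.fst (h0 ψ)
  have hy0 (ψ) : y ψ 0 = lam * ((π / 2) ^ 2 - ψ ^ 2) := congrArg Prod.snd (h0 ψ)
  have hsol (ψ) : ∀ t ∈ Ici (0 : ℝ), HasDerivWithinAt (x ψ) (y ψ t) (Ici 0) t ∧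
      HasDerivWithinAt (y ψ) (sin (x ψ t) - a t * cos (x ψ t)) (Ici 0) t := fun t ht ↦
    ⟨(hγ ψ t ht).fst, (hγ ψ t ht).snd⟩
  have hcont (ψ) : ContinuousOn (x ψ) (Ici 0) := fun t ht ↦ (hsol ψ t ht).1.continuousWithinAt
  have hdep (ψ₀ T : ℝ) : ∀ ε > 0, ∀ᶠ ψ in 𝓝 ψ₀, ∀ s ∈ Icc 0 T, |x ψ s - x ψ₀ s| < ε := by
    intro ε hε
    obtain ⟨C, hC⟩ := exists_dist_le_mul_of_isIntegralCurveOn_pendulumField ha.continuousOn T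
    have hlim : Tendsto (fun ψ ↦ dist (start ψ) (start ψ₀) * C) (𝓝 ψ₀) (𝓝 0) := by
      have : Continuous fun ψ ↦ dist (start ψ) (start ψ₀) * C := by fun_prop
      simpa using this.tendsto ψ₀
    filter_upwards [hlim.eventually_lt_const hε] with ψ hψ s hs
    have := hC (γ ψ) (γ ψ₀) ((hγ ψ).mono Icc_subset_Ici_self)
      ((hγ ψ₀).mono Icc_subset_Ici_self) s hs
    rw [h0, h0] at this
    exact (le_max_left _ _).trans_lt (this.trans_lt hψ)
  have hy_zero (ψ) (h : |ψ| = π / 2) : y ψ 0 = 0 := by rw [hy0, ← sq_abs ψ, h]; ring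
  have hpi := pi_div_two_pos
  by_cases hex : ∃ ψ ∈ Icc (-(π / 2)) (π / 2),
      ¬ ExitsAbove (π / 2) (x ψ) ∧ ¬ ExitsAbove (π / 2) (-x ψ)
  · obtain ⟨ψ, hψ, habove, hbelow⟩ := hex
    have habs := abs_lt_of_not_exitsAbove (hsol ψ) (by rw [hx0]; exact abs_le.2 hψ)
      (by rw [hx0]; exact hy_zero ψ) habove hbelow
    exact ⟨ψ, abs_lt.1 (hx0 ψ ▸ habs 0 self_mem_Ici), x ψ, y ψ, hsol ψ,
      contDiffOn_four_of_solution ha (hsol ψ), hx0 ψ, hy0 ψ, habs⟩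
  · push Not at hex
    obtain ⟨ψ, -, hψ⟩ := isPreconnected_Icc (a := -(π / 2)) (b := π / 2)
      {ψ | ExitsAbove (π / 2) (x ψ)} {ψ | ExitsAbove (π / 2) (-x ψ)}
      (isOpen_setOf_exitsAbove _ hcont hdep)
      (isOpen_setOf_exitsAbove _ (fun ψ ↦ (hcont ψ).neg) fun ψ₀ T ε hε ↦ by
        filter_upwards [hdep ψ₀ T ε hε] with ψ hψ s hs
        rw [Pi.neg_apply, Pi.neg_apply, ← neg_sub', abs_neg]
        exact hψ s hs)
      (fun ψ hψ ↦ or_iff_not_imp_left.2 (hex ψ hψ))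
      ⟨π / 2, by simp [hpi.le], exitsAbove_of_hits le_rfl (hsol _) (hx0 _) (by simp)
        fun _ ↦ hy_zero _ (abs_of_pos hpi)⟩
      ⟨-(π / 2), by simp [hpi.le], exitsAbove_of_hits le_rfl (neg_solution (hsol _))
        (by simp [hx0]) (by simp)
        fun _ ↦ by simp [hy_zero _ (by rw [abs_neg, abs_of_pos hpi] : |-(π / 2)| = π / 2)]⟩
    exact (not_exitsAbove_and_exitsAbove_neg hψ).elim
end
end

section
/- Let w ∈ C⁴(ℝ≥0) and let φ be a solution of the Whitney pendulum equation φ̈ = sin φ − ẅ(t) cos φ on an interval [0, T). Then there is a constant (depending only on the initial conditions φ(0), φ̇(0) and on ẅ(0)) such that for all t in the interval of existence, (φ̇(t))² ≤ const + 2(∫₀ᵗ |w'''(s)| ds + |ẅ(t)|). -/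
open Set Real

noncomputable section

/-- The energy `φ̇² / 2 + cos φ + a sin φ` of a solution of `φ̈ = sin φ - a cos φ` changes at
rate `ȧ sin φ`. -/
theorem hasDerivWithinAt_pendulum_energy {a φ φ' : ℝ → ℝ} {a' t : ℝ} {s : Set ℝ}
    (ha : HasDerivWithinAt a a' s t) (hφ : HasDerivWithinAt φ (φ' t) s t)
    (hφ' : HasDerivWithinAt φ' (sin (φ t) - a t * cos (φ t)) s t) :
    HasDerivWithinAt (fun u => φ' u ^ 2 / 2 + cos (φ u) + a u * sin (φ u))
      (a' * sin (φ t)) s t := by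
  refine ((((hφ'.pow 2).div_const 2).add hφ.cos).add (ha.mul hφ.sin)).congr_deriv ?_
  push_cast
  ring

/-- Energy balance for the pendulum equation `φ̈ = sin φ - a cos φ` on `[0, T)`. -/
theorem pendulum_energy_le {a a' φ φ' : ℝ → ℝ} {T t : ℝ}
    (ha : ∀ u ∈ Ico 0 T, HasDerivWithinAt a (a' u) (Ico 0 T) u)
    (ha' : ContinuousOn a' (Ico 0 T))
    (hφ : ∀ u ∈ Ico 0 T, HasDerivWithinAt φ (φ' u) (Ico 0 T) u)
    (hφ' : ∀ u ∈ Ico 0 T, HasDerivWithinAt φ' (sin (φ u) - a u * cos (φ u)) (Ico 0 T) u)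
    (ht : t ∈ Ico 0 T) :
    φ' t ^ 2 / 2 + cos (φ t) + a t * sin (φ t) ≤
      φ' 0 ^ 2 / 2 + cos (φ 0) + a 0 * sin (φ 0) + ∫ s in (0 : ℝ)..t, |a' s| := by
  have hE := fun u hu => hasDerivWithinAt_pendulum_energy (ha u hu) (hφ u hu) (hφ' u hu)
  have hsub : Icc 0 t ⊆ Ico 0 T := Icc_subset_Ico_right ht.2
  have hcφ : ContinuousOn φ (Ico 0 T) := fun u hu => (hφ u hu).continuousWithinAt
  have hint : IntervalIntegrable (fun u => a' u * sin (φ u)) MeasureTheory.volume 0 t :=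
    ((ha'.mul (continuous_sin.comp_continuousOn hcφ)).mono hsub).intervalIntegrable_of_Icc ht.1
  have hint' : IntervalIntegrable (fun u => |a' u|) MeasureTheory.volume 0 t :=
    (ha'.mono hsub).abs.intervalIntegrable_of_Icc ht.1
  have hftc := intervalIntegral.integral_eq_sub_of_hasDerivAt_of_le ht.1
    (fun u hu => (hE u (hsub hu)).continuousWithinAt.mono hsub)
    (fun u hu => (hE u (hsub (Ioo_subset_Icc_self hu))).hasDerivAt
      (Ico_mem_nhds hu.1 (hu.2.trans ht.2))) hint
  have hle : ∫ s in (0 : ℝ)..t, a' s * sin (φ s) ≤ ∫ s in (0 : ℝ)..t, |a' s| := by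
    refine intervalIntegral.integral_mono_on ht.1 hint hint' fun s _ => ?_
    calc a' s * sin (φ s) ≤ |a' s| * |sin (φ s)| := by
          rw [← abs_mul]
          exact le_abs_self _
      _ ≤ |a' s| := mul_le_of_le_one_right (abs_nonneg _) (abs_sin_le_one _)
  linarith

/-- Energy estimate for the Whitney pendulum `φ̈ = sin φ − ẅ(t) cos φ`: there is a
constant, depending only on the initial conditions `φ(0)`, `φ̇(0)` and on `ẅ(0)`,
such that along any solution on `[0, T)`,
`(φ̇(t))² ≤ const + 2(∫₀ᵗ |w'''(s)| ds + |ẅ(t)|)`. -/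
theorem whitney_pendulum_velocity_estimate :
    ∃ K : ℝ → ℝ → ℝ → ℝ, ∀ (w φ φ' : ℝ → ℝ) (T : ℝ),
      ContDiffOn ℝ 4 w (Ici 0) →
      (∀ t ∈ Ico (0:ℝ) T, HasDerivWithinAt φ (φ' t) (Ico 0 T) t ∧
        HasDerivWithinAt φ'
          (Real.sin (φ t) - iteratedDerivWithin 2 w (Ici 0) t * Real.cos (φ t)) (Ico 0 T) t) →
      ∀ t ∈ Ico (0:ℝ) T,
        (φ' t)^2 ≤ K (φ 0) (φ' 0) (iteratedDerivWithin 2 w (Ici 0) 0) +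
          2 * ((∫ s in (0:ℝ)..t, |iteratedDerivWithin 3 w (Ici 0) s|) +
            |iteratedDerivWithin 2 w (Ici 0) t|) := by
  refine ⟨fun x p b => p ^ 2 + 2 * cos x + 2 * b * sin x + 2, fun w φ φ' T hw hsol t ht => ?_⟩
  have hsub : Ico 0 T ⊆ Ici (0 : ℝ) := Ico_subset_Ici_self
  have ha : ∀ u ∈ Ico 0 T, HasDerivWithinAt (iteratedDerivWithin 2 w (Ici 0))
      (iteratedDerivWithin 3 w (Ici 0) u) (Ico 0 T) u := fun u hu => by
    rw [iteratedDerivWithin_succ (n := 2)]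
    exact (hw.differentiableOn_iteratedDerivWithin (m := 2) (by norm_num) (uniqueDiffOn_Ici 0) u
      (hsub hu)).hasDerivWithinAt.mono hsub
  have ha' : ContinuousOn (iteratedDerivWithin 3 w (Ici 0)) (Ico 0 T) :=
    (hw.continuousOn_iteratedDerivWithin (by norm_num) (uniqueDiffOn_Ici 0)).mono hsub
  have henergy := pendulum_energy_le ha ha' (fun u hu => (hsol u hu).1)
    (fun u hu => (hsol u hu).2) ht
  have hforce : -(iteratedDerivWithin 2 w (Ici 0) t * sin (φ t)) ≤
      |iteratedDerivWithin 2 w (Ici 0) t| :=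
    calc _ ≤ |iteratedDerivWithin 2 w (Ici 0) t| * |sin (φ t)| := by
          rw [← abs_mul]
          exact neg_le_abs _
      _ ≤ _ := mul_le_of_le_one_right (abs_nonneg _) (abs_sin_le_one _)
  linarith [neg_one_le_cos (φ t)]
end
end

section
/- Let φ ∈ C³(ℝ≥0) be a given law of rotation satisfying (φ̇(t))² ≥ C > 0 for all t ≥ 0, and consider the equation of motion of the ring, r̈ = (φ̇(t))² r − sin(φ(t)). Let r_* > 0 be any constant with r_* C > 1. Then there exists an initial position r₀ with |r₀| < r_* such that the solution r(t) with r(0) = r₀ and ṙ(0) = 0 is defined for all t ≥ 0 and satisfies |r(t)| < r_* for all t ≥ 0. -/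
open Set Real

noncomputable section

open Filter Topology BoundedContinuousFunction

/-- A continuous time-dependent vector field on a Banach space which is Lipschitz in space, with a
Lipschitz constant depending continuously on time, has a solution on `[0, ∞)` through every
initial value. The proof is a contraction argument in an exponentially weighted sup norm. -/
theorem exists_forall_nonneg_hasDerivAt_of_lipschitz {E : Type*} [NormedAddCommGroup E]
    [NormedSpace ℝ E] [CompleteSpace E] {v : ℝ → E → E} (hv : Continuous (Function.uncurry v))
    {K : ℝ → ℝ} (hK : Continuous K) (hlip : ∀ t x y, ‖v t x - v t y‖ ≤ K t * ‖x - y‖) (x₀ : E) :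
    ∃ x : ℝ → E, x 0 = x₀ ∧ ∀ t, 0 ≤ t → HasDerivAt x (v t (x t)) t := by
  have hv0 : Continuous fun t => v t 0 :=
    hv.comp (by fun_prop : Continuous fun t : ℝ => (t, (0 : E)))
  set L : ℝ → ℝ := fun t => 2 * (|K t| + ‖v t 0‖) with hL
  have hLc : Continuous L := by fun_prop
  have hL0 : ∀ t, 0 ≤ L t := fun t => by positivity
  set w : ℝ → ℝ := fun t => Real.exp (∫ s in (0 : ℝ)..t, L s) with hw
  have hwd : ∀ t, HasDerivAt w (L t * w t) t := fun t => by
    simpa [hw, mul_comm] using (hLc.integral_hasStrictDerivAt 0 t).hasDerivAt.exp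
  have hwc : Continuous w := continuous_iff_continuousAt.2 fun t => (hwd t).continuousAt
  have hw_pos : ∀ t, 0 < w t := fun t => Real.exp_pos _
  have hw_one : ∀ t, 0 ≤ t → 1 ≤ w t := fun t ht =>
    Real.one_le_exp (intervalIntegral.integral_nonneg ht fun s _ => hL0 s)
  have hw_int : ∀ t, ∫ s in (0 : ℝ)..t, L s * w s = w t - 1 := fun t => by
    rw [intervalIntegral.integral_eq_sub_of_hasDerivAt (fun s _ => hwd s)
      ((hLc.mul hwc).intervalIntegrable _ _)]
    simp [hw]
  have hint_le : ∀ (g : ℝ → E) (M t : ℝ), 0 ≤ M → 0 ≤ t →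
      (∀ s, 0 ≤ s → ‖g s‖ ≤ M * (L s * w s)) → ‖∫ s in (0 : ℝ)..t, g s‖ ≤ M * w t := by
    intro g M t hM ht hg
    calc ‖∫ s in (0 : ℝ)..t, g s‖ ≤ ∫ s in (0 : ℝ)..t, M * (L s * w s) :=
          intervalIntegral.norm_integral_le_of_norm_le ht
            (Eventually.of_forall fun s hs => hg s hs.1.le)
            ((continuous_const.mul (hLc.mul hwc)).intervalIntegrable _ _)
      _ = M * (w t - 1) := by rw [intervalIntegral.integral_const_mul, hw_int]
      _ ≤ M * w t := by nlinarith
  have hFc : ∀ f : ℝ →ᵇ E, Continuous fun s => v s (w s • f s) := fun f =>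
    hv.comp (by fun_prop : Continuous fun s => (s, w s • f s))
  set I : (ℝ →ᵇ E) → ℝ → E := fun f t => ∫ s in (0 : ℝ)..t, v s (w s • f s) with hI
  have hId : ∀ f t, HasDerivAt (I f) (v t (w t • f t)) t := fun f t =>
    ((hFc f).integral_hasStrictDerivAt 0 t).hasDerivAt
  have hIc : ∀ f, Continuous (I f) := fun f =>
    continuous_iff_continuousAt.2 fun t => (hId f t).continuousAt
  have hI_le : ∀ f t, 0 ≤ t → ‖I f t‖ ≤ (‖f‖ + 1) / 2 * w t := by
    intro f t ht
    refine hint_le _ _ t (by positivity) ht fun s hs => ?_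
    have h1 : ‖v s (w s • f s)‖ ≤ K s * ‖w s • f s‖ + ‖v s 0‖ := by
      have := hlip s (w s • f s) 0
      rw [sub_zero] at this
      linarith [norm_le_norm_sub_add (v s (w s • f s)) (v s 0)]
    have h2 : ‖w s • f s‖ ≤ w s * ‖f‖ := by
      rw [norm_smul, Real.norm_of_nonneg (hw_pos s).le]
      exact mul_le_mul_of_nonneg_left (f.norm_coe_le_norm s) (hw_pos s).le
    have h3 : K s * ‖w s • f s‖ ≤ |K s| * (w s * ‖f‖) :=
      mul_le_mul (le_abs_self _) h2 (norm_nonneg _) (abs_nonneg _)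
    have h4 : ‖v s 0‖ ≤ ‖v s 0‖ * w s := le_mul_of_one_le_right (norm_nonneg _) (hw_one s hs)
    have h5 : 0 ≤ |K s| * w s := mul_nonneg (abs_nonneg _) (hw_pos s).le
    have h6 : 0 ≤ ‖v s 0‖ * w s * ‖f‖ :=
      mul_nonneg (mul_nonneg (norm_nonneg _) (hw_pos s).le) (norm_nonneg _)
    simp only [hL]
    nlinarith
  have hI_sub : ∀ f g t, 0 ≤ t → ‖I f t - I g t‖ ≤ ‖f - g‖ / 2 * w t := by
    intro f g t ht
    simp only [hI]
    rw [← intervalIntegral.integral_sub ((hFc f).intervalIntegrable _ _)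
      ((hFc g).intervalIntegrable _ _)]
    refine hint_le _ _ t (by positivity) ht fun s hs => ?_
    have h2 : ‖w s • f s - w s • g s‖ ≤ w s * ‖f - g‖ := by
      rw [← smul_sub, norm_smul, Real.norm_of_nonneg (hw_pos s).le]
      exact mul_le_mul_of_nonneg_left ((f - g).norm_coe_le_norm s) (hw_pos s).le
    have h3 : K s * ‖w s • f s - w s • g s‖ ≤ |K s| * (w s * ‖f - g‖) :=
      mul_le_mul (le_abs_self _) h2 (norm_nonneg _) (abs_nonneg _)
    have h6 : 0 ≤ ‖v s 0‖ * w s * ‖f - g‖ :=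
      mul_nonneg (mul_nonneg (norm_nonneg _) (hw_pos s).le) (norm_nonneg _)
    refine (hlip s _ _).trans (h3.trans ?_)
    simp only [hL]
    nlinarith
  let T : (ℝ →ᵇ E) → (ℝ →ᵇ E) := fun f =>
    BoundedContinuousFunction.ofNormedAddCommGroup
      (fun t => (w (max t 0))⁻¹ • (x₀ + I f (max t 0)))
      (((hwc.comp (by fun_prop)).inv₀ fun t => (hw_pos _).ne').smul
        (continuous_const.add ((hIc f).comp (by fun_prop))))
      (‖x₀‖ + (‖f‖ + 1) / 2) fun t => by
        rw [norm_smul, norm_inv, Real.norm_of_nonneg (hw_pos _).le,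
          inv_mul_le_iff₀ (hw_pos _)]
        have h1 := hI_le f (max t 0) (le_max_right _ _)
        have h2 := hw_one (max t 0) (le_max_right _ _)
        nlinarith [norm_add_le x₀ (I f (max t 0)), norm_nonneg x₀]
  have hT : ∀ f t, T f t = (w (max t 0))⁻¹ • (x₀ + I f (max t 0)) := fun _ _ => rfl
  have hcontr : ContractingWith (1 / 2) T := by
    refine ⟨by norm_num, LipschitzWith.of_dist_le_mul fun f g => ?_⟩
    rw [BoundedContinuousFunction.dist_le (by positivity)]
    intro t
    rw [hT, hT, dist_eq_norm, ← smul_sub, add_sub_add_left_eq_sub, norm_smul, norm_inv,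
      Real.norm_of_nonneg (hw_pos _).le, inv_mul_le_iff₀ (hw_pos _), dist_eq_norm]
    have := hI_sub f g (max t 0) (le_max_right _ _)
    push_cast
    linarith
  obtain ⟨f, hf⟩ : ∃ f, T f = f := ⟨_, hcontr.fixedPoint_isFixedPt⟩
  refine ⟨fun t => x₀ + I f t, by simp [hI], fun t ht => ?_⟩
  have hwf : w t • f t = x₀ + I f t := by
    conv_lhs => rw [← hf, hT, max_eq_left ht]
    exact smul_inv_smul₀ (hw_pos t).ne' _
  simpa only [← hwf] using (hId f t).const_add x₀

/-- The equation `r̈ = a r - b` with continuous coefficients has a solution on `[0, ∞)` for all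
initial data. -/
theorem exists_forall_nonneg_hasDerivAt_linear_second_order {a b : ℝ → ℝ} (ha : Continuous a)
    (hb : Continuous b) (x₀ y₀ : ℝ) :
    ∃ r r' : ℝ → ℝ, r 0 = x₀ ∧ r' 0 = y₀ ∧ ∀ t, 0 ≤ t →
      HasDerivAt r (r' t) t ∧ HasDerivAt r' (a t * r t - b t) t := by
  obtain ⟨x, hx0, hx⟩ := exists_forall_nonneg_hasDerivAt_of_lipschitz
    (v := fun t (p : ℝ × ℝ) => (p.2, a t * p.1 - b t)) (K := fun t => 1 + |a t|)
    (by unfold Function.uncurry; fun_prop) (by fun_prop) (fun t p q => by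
      rw [Prod.norm_def]
      have h1 : |(p - q).1| ≤ ‖p - q‖ := norm_fst_le (p - q)
      have h2 : |(p - q).2| ≤ ‖p - q‖ := norm_snd_le (p - q)
      have h3 := mul_le_mul_of_nonneg_left h1 (abs_nonneg (a t))
      have h4 := mul_nonneg (abs_nonneg (a t)) (norm_nonneg (p - q))
      have h5 : a t * p.1 - b t - (a t * q.1 - b t) = a t * (p - q).1 := by
        simp only [Prod.fst_sub]; ring
      refine max_le ?_ ?_
      · simp only [Prod.fst_sub, Prod.snd_sub, Real.norm_eq_abs] at *
        linarith
      · simp only [Prod.snd_sub, Real.norm_eq_abs] at *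
        rw [h5, abs_mul]
        linarith [norm_nonneg (p - q)]) (x₀, y₀)
  refine ⟨fun t => (x t).1, fun t => (x t).2, by simp [hx0], by simp [hx0], fun t ht => ?_⟩
  exact ⟨(hx t ht).fst, (hx t ht).snd⟩

/-- A maximum principle: a function with zero initial velocity which is strictly convex wherever
it exceeds `ρ` and ends at a value at most `ρ` is bounded by `ρ`. -/
theorem le_of_second_deriv_pos_of_lt {r r' q : ℝ → ℝ} {ρ T : ℝ}
    (hr : ∀ t, 0 ≤ t → HasDerivAt r (r' t) t) (hr' : ∀ t, 0 ≤ t → HasDerivAt r' (q t) t)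
    (h0 : r' 0 = 0) (hT : r T ≤ ρ) (hq : ∀ t, 0 ≤ t → ρ < r t → 0 < q t) :
    ∀ t ∈ Icc 0 T, r t ≤ ρ := by
  intro t ht
  by_contra! hlt
  obtain ⟨m, hm, hmax⟩ := isCompact_Icc.exists_isMaxOn ⟨t, ht⟩
    (fun s hs => (hr s hs.1).continuousAt.continuousWithinAt : ContinuousOn r (Icc 0 T))
  have hρm : ρ < r m := hlt.trans_le (hmax ht)
  have hmT : m < T := lt_of_le_of_ne hm.2 (by rintro rfl; exact absurd hT hρm.not_ge)
  have hm' : r' m = 0 := by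
    rcases hm.1.eq_or_lt with rfl | hpos
    · exact h0
    · exact (hmax.isLocalMax (Icc_mem_nhds hpos hmT)).hasDerivAt_eq_zero (hr m hm.1)
  have hpos : ∀ᶠ s in 𝓝[>] m, 0 < r' s := by
    have hslope := ((hasDerivAt_iff_tendsto_slope.1 (hr' m hm.1)).mono_left
      (nhdsWithin_mono m (fun s hs => (ne_of_gt hs : s ≠ m)))).eventually
        (lt_mem_nhds (hq m hm.1 hρm))
    filter_upwards [hslope, self_mem_nhdsWithin] with s hs hms
    rw [slope_def_field, hm', sub_zero] at hs
    exact (div_pos_iff_of_pos_right (sub_pos.2 hms)).1 hs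
  obtain ⟨u, hmu, hu⟩ := mem_nhdsGT_iff_exists_Ioo_subset.1 hpos
  obtain ⟨s, hms, hs⟩ := exists_between (lt_min hmT hmu)
  have hmono : StrictMonoOn r (Icc m s) := by
    refine strictMonoOn_of_deriv_pos (convex_Icc m s)
      (fun z hz => (hr z (hm.1.trans hz.1)).continuousAt.continuousWithinAt) fun z hz => ?_
    rw [interior_Icc] at hz
    rw [(hr z (hm.1.trans hz.1.le)).deriv]
    exact hu ⟨hz.1, hz.2.trans (hs.trans_le (min_le_right _ _))⟩
  have hlt := hmono (left_mem_Icc.2 hms.le) (right_mem_Icc.2 hms.le) hms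
  exact hlt.not_ge (hmax ⟨hm.1.trans hms.le, (hs.trans_le (min_le_left _ _)).le⟩)

/-- A solution of `ü = a u` with `a ≥ 0`, `u(0) = 1` and `u̇(0) = 0` never vanishes. -/
theorem ne_zero_of_second_deriv_eq_nonneg_mul {u u' a : ℝ → ℝ}
    (ha : ∀ t, 0 ≤ t → 0 ≤ a t) (hu : ∀ t, 0 ≤ t → HasDerivAt u (u' t) t)
    (hu' : ∀ t, 0 ≤ t → HasDerivAt u' (a t * u t) t) (h0 : u 0 = 1) (h0' : u' 0 = 0)
    {t : ℝ} (ht : 0 ≤ t) : u t ≠ 0 := by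
  have mono : ∀ f f' : ℝ → ℝ, (∀ s, 0 ≤ s → HasDerivAt f (f' s) s) → (∀ s, 0 ≤ s → 0 ≤ f' s) →
      MonotoneOn f (Ici 0) := fun f f' hf hf' => by
    refine monotoneOn_of_deriv_nonneg (convex_Ici 0)
      (fun s hs => (hf s hs).continuousAt.continuousWithinAt)
      (fun s hs => (hf s (interior_subset hs)).differentiableAt.differentiableWithinAt)
      fun s hs => ?_
    rw [(hf s (interior_subset hs)).deriv]
    exact hf' s (interior_subset hs)
  have huu' : ∀ s, 0 ≤ s → 0 ≤ u s * u' s := fun s hs => by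
    have := mono (fun s => u s * u' s) (fun s => u' s * u' s + u s * (a s * u s))
      (fun s hs => (hu s hs).mul (hu' s hs))
      (fun s hs => by nlinarith [mul_nonneg (ha s hs) (mul_self_nonneg (u s)),
        mul_self_nonneg (u' s)]) self_mem_Ici hs hs
    simpa [h0'] using this
  have := mono (fun s => u s * u s) (fun s => u' s * u s + u s * u' s)
    (fun s hs => (hu s hs).mul (hu s hs)) (fun s hs => by linarith [huu' s hs])
    self_mem_Ici ht ht
  simp only [h0] at this
  intro h
  simp only [h] at this
  norm_num at this

/-- The ring on the rotating rod: if the rod rotates with `(φ̇(t))² ≥ C > 0` and the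
half-length `r_*` of the rod satisfies `r_* C > 1`, then there is an initial position
`r₀`, `|r₀| < r_*`, such that the solution of `r̈ = (φ̇(t))² r − sin(φ(t))` with
`r(0) = r₀`, `ṙ(0) = 0` is defined for all `t ≥ 0` and satisfies `|r(t)| < r_*`:
the ring never slides off the rod. -/
theorem ring_on_rotating_rod (φ : ℝ → ℝ) (hφ : ContDiffOn ℝ 3 φ (Ici 0))
    (C : ℝ) (hC : 0 < C)
    (hspeed : ∀ t ∈ Ici (0:ℝ), C ≤ (derivWithin φ (Ici 0) t)^2)
    (rstar : ℝ) (hrstar : 0 < rstar) (hrC : 1 < rstar * C) :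
    ∃ r₀ : ℝ, |r₀| < rstar ∧ ∃ r r' : ℝ → ℝ,
      (∀ t ∈ Ici (0:ℝ), HasDerivWithinAt r (r' t) (Ici 0) t ∧
        HasDerivWithinAt r'
          ((derivWithin φ (Ici 0) t)^2 * r t - Real.sin (φ t)) (Ici 0) t) ∧
      r 0 = r₀ ∧ r' 0 = 0 ∧
      ∀ t ∈ Ici (0:ℝ), |r t| < rstar := by
  set a : ℝ → ℝ := fun t => (derivWithin φ (Ici 0) (max t 0)) ^ 2 with ha
  set b : ℝ → ℝ := fun t => Real.sin (φ (max t 0)) with hb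
  have hmax : Continuous fun t : ℝ => max t 0 := by fun_prop
  have hac : Continuous a :=
    ((hφ.continuousOn_derivWithin (uniqueDiffOn_Ici 0) (by norm_num)).comp_continuous hmax
      fun t => le_max_right t 0).pow 2
  have hbc : Continuous b :=
    Real.continuous_sin.comp (hφ.continuousOn.comp_continuous hmax fun t => le_max_right t 0)
  have haC : ∀ t, C ≤ a t := fun t => hspeed _ (le_max_right t 0)
  obtain ⟨u, u', hu0, hu0', hu⟩ :=
    exists_forall_nonneg_hasDerivAt_linear_second_order hac (continuous_const (y := 0)) 1 0
  obtain ⟨v, v', hv0, hv0', hv⟩ :=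
    exists_forall_nonneg_hasDerivAt_linear_second_order hac hbc 0 0
  have hr : ∀ c t, 0 ≤ t → HasDerivAt (fun s => c * u s + v s) (c * u' t + v' t) t :=
    fun c t ht => ((hu t ht).1.const_mul c).add (hv t ht).1
  have hr' : ∀ c t, 0 ≤ t →
      HasDerivAt (fun s => c * u' s + v' s) (a t * (c * u t + v t) - b t) t := fun c t ht =>
    (((hu t ht).2.const_mul c).add (hv t ht).2).congr_deriv (by ring)
  have hune : ∀ t, 0 ≤ t → u t ≠ 0 := fun t ht =>
    ne_zero_of_second_deriv_eq_nonneg_mul (fun s _ => hC.le.trans (haC s))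
      (fun s hs => (hu s hs).1) (fun s hs => by simpa using (hu s hs).2) hu0 hu0' ht
  obtain ⟨ρ, hCρ, hρ⟩ : ∃ ρ, 1 / C < ρ ∧ ρ < rstar :=
    exists_between ((div_lt_iff₀ hC).2 hrC)
  rw [div_lt_iff₀ hC] at hCρ
  have hρ0 : 0 < ρ := by by_contra! h; nlinarith
  have hforce : ∀ t x, ρ < x → b t < a t * x ∧ -b t < a t * x := by
    intro t x hx
    have h1 : ρ * C < a t * x := by nlinarith [haC t]
    exact ⟨by linarith [Real.sin_le_one (φ (max t 0))],
      by linarith [Real.neg_one_le_sin (φ (max t 0))]⟩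
  -- `c n` is the initial position of the solution that vanishes at time `n`
  set c : ℕ → ℝ := fun n => -v n / u n with hc
  have hbound : ∀ n : ℕ, ∀ t ∈ Icc (0 : ℝ) n, |c n * u t + v t| ≤ ρ := by
    intro n t ht
    have hn : c n * u n + v n = 0 := by
      simp [hc, div_mul_cancel₀ _ (hune n n.cast_nonneg)]
    refine abs_le'.2 ⟨?_, ?_⟩
    · exact le_of_second_deriv_pos_of_lt (hr (c n)) (hr' (c n)) (by simp [hu0', hv0'])
        (by linarith) (fun s _ hs => by linarith [(hforce s _ hs).1]) t ht
    · exact le_of_second_deriv_pos_of_lt (fun s hs => (hr (c n) s hs).fun_neg)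
        (fun s hs => (hr' (c n) s hs).fun_neg) (by simp [hu0', hv0'])
        (by linarith) (fun s _ hs => by linarith [(hforce s _ hs).2]) t ht
  have hcmem : ∀ n, c n ∈ Icc (-ρ) ρ := fun n => by
    simpa [hu0, hv0, abs_le] using hbound n 0 ⟨le_rfl, n.cast_nonneg⟩
  obtain ⟨r₀, hr₀, k, hk, hlim⟩ := isCompact_Icc.tendsto_subseq hcmem
  have hle : ∀ t, 0 ≤ t → |r₀ * u t + v t| ≤ ρ := fun t ht => by
    refine le_of_tendsto ((hlim.mul_const (u t)).add_const (v t)).abs ?_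
    filter_upwards [(tendsto_natCast_atTop_atTop.comp hk.tendsto_atTop).eventually_ge_atTop t]
      with n hn
    exact hbound (k n) t ⟨ht, hn⟩
  refine ⟨r₀, (abs_le.2 hr₀).trans_lt hρ, fun t => r₀ * u t + v t, fun t => r₀ * u' t + v' t,
    fun t ht => ⟨(hr r₀ t ht).hasDerivWithinAt, ?_⟩, by simp [hu0, hv0], by simp [hu0', hv0'],
    fun t ht => (hle t ht).trans_lt hρ⟩
  simpa [ha, hb, max_eq_left (show (0 : ℝ) ≤ t from ht)] using (hr' r₀ t ht).hasDerivWithinAt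
end
end

section
/- Let M ⊆ ℝ^m be a domain, f : ℝ≥0 × M × ℝ^m → ℝ^m C²-smooth, F ∈ C⁴(M), c ∈ ℝ, and suppose the transversality condition holds: for every (t, x) ∈ ℝ≥0 × ∂D_c and every ξ ∈ ℝ^m, dF(x)[ξ] = 0 implies dF(x)[f(t,x,ξ)] + d²F(x)[ξ,ξ] > 0. Let x(t) be a solution of ẍ = f(t, x, ẋ) defined on [0, τ] with τ > 0, such that x(t) ∈ D_c for all t ∈ [0, τ) and F(x(τ)) = c. Then dF(x(τ))[ẋ(τ)] > 0. -/
open Set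

noncomputable section

/-- `x, x'` form a solution of the second-order system `ẍ = f(t, x, ẋ)` on the
time set `s`, with the curve staying in the domain `M`. -/
def IsSolOn {m : ℕ} (M : Set (EuclideanSpace ℝ (Fin m)))
    (f : ℝ → EuclideanSpace ℝ (Fin m) → EuclideanSpace ℝ (Fin m) → EuclideanSpace ℝ (Fin m))
    (x x' : ℝ → EuclideanSpace ℝ (Fin m)) (s : Set ℝ) : Prop :=
  ∀ t ∈ s, x t ∈ M ∧ HasDerivWithinAt x (x' t) s t ∧
    HasDerivWithinAt x' (f t (x t) (x' t)) s t

open Filter Topology in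
/-- A function on `[a, b]` that lies strictly below its final value before time `b` has positive
final derivative, provided its second derivative at `b` is positive whenever the first vanishes. -/
lemma pos_deriv_right_of_lt {g g' : ℝ → ℝ} {a b k : ℝ} (hab : a < b)
    (hg : ∀ t ∈ Icc a b, HasDerivWithinAt g (g' t) (Icc a b) t)
    (hg' : HasDerivWithinAt g' k (Icc a b) b)
    (hlt : ∀ t ∈ Ico a b, g t < g b) (hk : g' b = 0 → 0 < k) : 0 < g' b := by
  by_contra! hle
  have hIio : HasDerivWithinAt g' k (Iio b) b :=
    hg'.mono_of_mem_nhdsWithin (mem_of_superset (Ico_mem_nhdsLT hab) Ico_subset_Icc_self)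
  have hneg : ∀ᶠ t in 𝓝[<] b, g' t < 0 := by
    rcases hle.lt_or_eq with h | h
    · exact hIio.continuousWithinAt.eventually_lt_const h
    · have hslope := (hasDerivWithinAt_iff_tendsto_slope' (by simp)).1 hIio
      filter_upwards [hslope.eventually_const_lt (hk h), self_mem_nhdsWithin] with t ht htb
      rw [slope_def_field, h, sub_zero] at ht
      have htb' : t - b < 0 := sub_neg.2 htb
      by_contra! h0
      exact absurd ht (not_lt.2 (div_nonpos_of_nonneg_of_nonpos h0 htb'.le))
  obtain ⟨l, hl, hsub⟩ := (mem_nhdsLT_iff_exists_mem_Ico_Ioo_subset hab).1 hneg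
  have hanti : StrictAntiOn g (Icc l b) := by
    refine strictAntiOn_of_deriv_neg (convex_Icc l b)
      (fun t ht => ((hg t ⟨hl.1.trans ht.1, ht.2⟩).continuousWithinAt).mono
        (Icc_subset_Icc_left hl.1)) fun t ht => ?_
    rw [interior_Icc] at ht
    have hat : a < t := hl.1.trans_lt ht.1
    rw [((hg t ⟨hat.le, ht.2.le⟩).hasDerivAt (Icc_mem_nhds hat ht.2)).deriv]
    exact hsub ht
  exact (hlt l hl).not_gt (hanti (left_mem_Icc.2 hl.2.le) (right_mem_Icc.2 hl.2.le) hl.2)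

/-- Lemma 1: a solution reaching the boundary `∂D_c = F⁻¹(c)` at time `τ` after
staying in `D_c` crosses it transversally: `dF(x(τ))[ẋ(τ)] > 0`. -/
theorem exit_velocity_transversal {m : ℕ} (M : Set (EuclideanSpace ℝ (Fin m)))
    (hMopen : IsOpen M) (hMconn : IsConnected M)
    (f : ℝ → EuclideanSpace ℝ (Fin m) → EuclideanSpace ℝ (Fin m) → EuclideanSpace ℝ (Fin m))
    (hf : ContDiffOn ℝ 2
      (fun p : ℝ × EuclideanSpace ℝ (Fin m) × EuclideanSpace ℝ (Fin m) => f p.1 p.2.1 p.2.2)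
      (Ici 0 ×ˢ M ×ˢ univ))
    (F : EuclideanSpace ℝ (Fin m) → ℝ) (hF : ContDiffOn ℝ 4 F M) (c : ℝ)
    (Dc bDc : Set (EuclideanSpace ℝ (Fin m)))
    (hDc : Dc = {x ∈ M | F x < c}) (hbDc : bDc = {x ∈ M | F x = c})
    -- transversality condition on the boundary
    (h3 : ∀ t ∈ Ici (0:ℝ), ∀ x ∈ bDc, ∀ ξ : EuclideanSpace ℝ (Fin m),
      fderiv ℝ F x ξ = 0 →
      0 < fderiv ℝ F x (f t x ξ) + fderiv ℝ (fderiv ℝ F) x ξ ξ)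
    (τ : ℝ) (hτ : 0 < τ) (x x' : ℝ → EuclideanSpace ℝ (Fin m))
    (hsol : IsSolOn M f x x' (Icc 0 τ))
    (hin : ∀ t ∈ Ico (0:ℝ) τ, x t ∈ Dc)
    (hexit : F (x τ) = c) :
    0 < fderiv ℝ F (x τ) (x' τ) := by
  subst hDc hbDc
  have hFx : ∀ t ∈ Icc 0 τ, ContDiffAt ℝ 4 F (x t) := fun t ht =>
    hF.contDiffAt (hMopen.mem_nhds (hsol t ht).1)
  have hτmem : τ ∈ Icc 0 τ := right_mem_Icc.2 hτ.le
  obtain ⟨hxM, hx, hx'⟩ := hsol τ hτmem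
  have hdF : DifferentiableAt ℝ (fderiv ℝ F) (x τ) :=
    ((hFx τ hτmem).fderiv_right (m := 1) (by norm_num)).differentiableAt (by norm_num)
  refine pos_deriv_right_of_lt (g := fun t => F (x t)) (g' := fun t => fderiv ℝ F (x t) (x' t)) hτ
    (fun t ht => ((hFx t ht).differentiableAt (by norm_num)).hasFDerivAt.comp_hasDerivWithinAt t
      (hsol t ht).2.1)
    ((hdF.hasFDerivAt.comp_hasDerivWithinAt τ hx).clm_apply hx')
    (fun t ht => (hin t ht).2.trans_eq hexit.symm) fun h => ?_
  rw [add_comm]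
  exact h3 τ hτ.le (x τ) ⟨hxM, hexit⟩ (x' τ) h
end
end

section
/- Let M ⊆ ℝ^m be a domain, f : ℝ≥0 × M × ℝ^m → ℝ^m C²-smooth, F ∈ C⁴(M), c ∈ ℝ, with the closure of D_c compact and contained in M, and suppose the transversality condition holds: for every (t, x) ∈ ℝ≥0 × ∂D_c and every ξ ∈ ℝ^m, dF(x)[ξ] = 0 implies dF(x)[f(t,x,ξ)] + d²F(x)[ξ,ξ] > 0. Let v : M → ℝ^m be a continuous vector field, and for y ∈ D_c let x(t, y) denote the solution of ẍ = f(t, x, ẋ) with x(0, y) = y, ẋ(0, y) = v(y). Assume every such solution leaves D_c, and let τ(y) > 0 be the first time at which F(x(τ(y), y)) = c. Then the function y ↦ τ(y) is continuous on D_c. -/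
open Set

noncomputable section

open Filter Topology Metric
open scoped NNReal

/-- A `C¹` time-dependent vector field is Lipschitz in space, uniformly in time, on a tube around a
continuous curve over a compact time interval. -/
lemma exists_lipschitzOnWith_tube {E : Type*} [NormedAddCommGroup E] [NormedSpace ℝ E]
    {V : ℝ → E → E} {S : Set E} (hS : IsOpen S)
    (hV : ContDiffOn ℝ 1 (fun p : ℝ × E => V p.1 p.2) (Ici 0 ×ˢ S))
    {z : ℝ → E} {T : ℝ} (hz : ContinuousOn z (Icc 0 T)) (hzS : ∀ t ∈ Icc 0 T, z t ∈ S) :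
    ∃ r > 0, ∃ K : ℝ≥0, ∀ t ∈ Icc 0 T, LipschitzOnWith K (V t) (ball (z t) r) := by
  refine isCompact_Icc.induction_on
    (p := fun s => ∃ r > 0, ∃ K : ℝ≥0, ∀ t ∈ s, LipschitzOnWith K (V t) (ball (z t) r))
    ⟨1, one_pos, 0, by simp⟩ ?_ ?_ ?_
  · rintro s t hst ⟨r, hr, K, h⟩
    exact ⟨r, hr, K, fun u hu => h u (hst hu)⟩
  · rintro s t ⟨r, hr, K, h⟩ ⟨r', hr', K', h'⟩
    refine ⟨min r r', lt_min hr hr', max K K', ?_⟩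
    rintro u (hu | hu)
    · exact ((h u hu).weaken (le_max_left _ _)).mono (ball_subset_ball (min_le_left _ _))
    · exact ((h' u hu).weaken (le_max_right _ _)).mono (ball_subset_ball (min_le_right _ _))
  · intro t₀ ht₀
    obtain ⟨r₁, hr₁, hball⟩ := isOpen_iff.1 hS _ (hzS t₀ ht₀)
    have hsub : Ici (0 : ℝ) ×ˢ ball (z t₀) r₁ ⊆ Ici 0 ×ˢ S := prod_mono le_rfl hball
    obtain ⟨K, U, hU, hK⟩ := (hV.mono hsub (t₀, z t₀)
      ⟨ht₀.1, mem_ball_self hr₁⟩).exists_lipschitzOnWith ((convex_Ici 0).prod (convex_ball _ _))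
    obtain ⟨ρ, hρ, hρU⟩ := mem_nhdsWithin_iff.1 hU
    have hr : 0 < min ρ r₁ / 2 := half_pos (lt_min hρ hr₁)
    refine ⟨_, inter_mem (inter_mem self_mem_nhdsWithin
      (mem_nhdsWithin_of_mem_nhds (ball_mem_nhds t₀ hρ)))
      (hz t₀ ht₀ (ball_mem_nhds (z t₀) hr)), min ρ r₁ / 2, hr, K, ?_⟩
    rintro t ⟨⟨htT, htρ⟩, htz⟩
    have hmem : ∀ x ∈ ball (z t) (min ρ r₁ / 2), (t, x) ∈ U := by
      intro x hx
      have hx' : dist x (z t₀) < min ρ r₁ := by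
        have h₁ : dist x (z t) < min ρ r₁ / 2 := hx
        have h₂ : dist (z t) (z t₀) < min ρ r₁ / 2 := htz
        linarith [dist_triangle x (z t) (z t₀)]
      refine hρU ⟨?_, htT.1, hx'.trans_le (min_le_right _ _)⟩
      rw [mem_ball, Prod.dist_eq]
      exact max_lt htρ (hx'.trans_le (min_le_left _ _))
    refine LipschitzOnWith.of_dist_le_mul fun x hx y hy => ?_
    simpa [Prod.dist_eq] using hK.dist_le_mul _ (hmem x hx) _ (hmem y hy)

/-- Solutions of `ż = V(t, z)` depend continuously on the initial value, uniformly on compact time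
intervals. -/
lemma exists_dist_lt_of_dist_initial_lt {E : Type*} [NormedAddCommGroup E] [NormedSpace ℝ E]
    {V : ℝ → E → E} {S : Set E} (hS : IsOpen S)
    (hV : ContDiffOn ℝ 1 (fun p : ℝ × E => V p.1 p.2) (Ici 0 ×ˢ S))
    {z : ℝ → E} (hz : ∀ t ∈ Ici (0 : ℝ), HasDerivWithinAt z (V t (z t)) (Ici 0) t)
    (hzS : ∀ t ∈ Ici (0 : ℝ), z t ∈ S) (T : ℝ) {ε : ℝ} (hε : 0 < ε) :
    ∃ δ > 0, ∀ w : ℝ → E, (∀ t ∈ Ici (0 : ℝ), HasDerivWithinAt w (V t (w t)) (Ici 0) t) →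
      dist (w 0) (z 0) < δ → ∀ t ∈ Icc 0 T, dist (w t) (z t) < ε := by
  have hcont : ∀ (w : ℝ → E), (∀ t ∈ Ici (0 : ℝ), HasDerivWithinAt w (V t (w t)) (Ici 0) t) →
      ∀ b, ContinuousOn w (Icc 0 b) := fun w hw b t ht =>
    ((hw t ht.1).continuousWithinAt).mono Icc_subset_Ici_self
  obtain ⟨r, hr, K, hK⟩ := exists_lipschitzOnWith_tube hS hV (hcont z hz T)
    fun t ht => hzS t ht.1
  have hη : 0 < min ε r := lt_min hε hr
  refine ⟨min ε r / Real.exp (K * T), by positivity, fun w hw hw₀ => ?_⟩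
  suffices h : ∀ t ∈ Icc 0 T, dist (w t) (z t) < min ε r from
    fun t ht => (h t ht).trans_le (min_le_left _ _)
  by_contra! hcon
  obtain ⟨t₀, ht₀, hd₀⟩ := hcon
  have hcomp : IsCompact (Icc 0 T ∩ (fun t => dist (w t) (z t)) ⁻¹' Ici (min ε r)) :=
    isCompact_Icc.of_isClosed_subset
      ((continuous_dist.comp_continuousOn
        ((hcont w hw T).prodMk (hcont z hz T))).preimage_isClosed_of_isClosed
          isClosed_Icc isClosed_Ici)
      inter_subset_left
  obtain ⟨t₁, ⟨ht₁, hd₁⟩, hleast⟩ := hcomp.exists_isLeast ⟨t₀, ht₀, hd₀⟩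
  have hlt : ∀ t ∈ Ico 0 t₁, dist (w t) (z t) < min ε r := by
    intro t ht
    by_contra! hge
    exact absurd (hleast ⟨⟨ht.1, ht.2.le.trans ht₁.2⟩, hge⟩) (not_le.2 ht.2)
  have hgron := dist_le_of_trajectories_ODE_of_mem (v := V) (s := fun t => ball (z t) r)
    (fun t ht => hK t ⟨ht.1, ht.2.le.trans ht₁.2⟩) (hcont w hw t₁)
    (fun t ht => (hw t ht.1).mono (Ici_subset_Ici.2 ht.1))
    (fun t ht => (hlt t ht).trans_le (min_le_right _ _)) (hcont z hz t₁)
    (fun t ht => (hz t ht.1).mono (Ici_subset_Ici.2 ht.1))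
    (fun t _ => mem_ball_self hr) le_rfl t₁ ⟨ht₁.1, le_rfl⟩
  have hexp : Real.exp (K * (t₁ - 0)) ≤ Real.exp (K * T) := by
    rw [sub_zero]
    gcongr
    exact ht₁.2
  have hfin : dist (w t₁) (z t₁) < min ε r :=
    calc dist (w t₁) (z t₁) ≤ dist (w 0) (z 0) * Real.exp (K * (t₁ - 0)) := hgron
      _ ≤ dist (w 0) (z 0) * Real.exp (K * T) := by gcongr
      _ < min ε r := (lt_div_iff₀ (Real.exp_pos _)).1 hw₀
  exact absurd hd₁ (not_le.2 hfin)

/-- A function reaching the value `c` from below at time `τ`, and having positive second derivative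
there whenever its first derivative vanishes, crosses the level `c` with positive speed. -/
lemma deriv_pos_of_first_hit {g h : ℝ → ℝ} {h' τ c : ℝ} (hτ : 0 < τ)
    (hg : ∀ t > 0, HasDerivAt g (h t) t) (hh : HasDerivAt h h' τ) (hh' : h τ = 0 → 0 < h')
    (hgτ : g τ = c) (hlt : ∀ t ∈ Ico 0 τ, g t < c) : 0 < h τ := by
  by_contra! hle
  have hneg : ∀ᶠ t in 𝓝[<] τ, h t < 0 := by
    rcases hle.lt_or_eq with hlt₀ | heq
    · exact (hh.continuousAt.eventually_lt_const hlt₀).filter_mono nhdsWithin_le_nhds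
    · have hs := (hasDerivAt_iff_tendsto_slope_left_right.1 hh).1
      filter_upwards [hs.eventually_const_lt (hh' heq), self_mem_nhdsWithin] with t ht htτ
      have htτ' : t - τ < 0 := sub_neg.2 htτ
      rw [slope_def_field, heq, sub_zero] at ht
      by_contra! hnn
      exact absurd ht (not_lt.2 (div_nonpos_of_nonneg_of_nonpos hnn htτ'.le))
  obtain ⟨a, ha, hsub⟩ := (mem_nhdsLT_iff_exists_Ioo_subset' hτ).1 hneg
  have hb : max a (τ / 2) < τ := max_lt ha (by linarith)
  have hb₀ : 0 < max a (τ / 2) := lt_max_of_lt_right (by linarith)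
  have hanti : StrictAntiOn g (Icc (max a (τ / 2)) τ) := by
    refine strictAntiOn_of_deriv_neg (convex_Icc _ _)
      (fun t ht => (hg t (hb₀.trans_le ht.1)).continuousAt.continuousWithinAt) fun t ht => ?_
    rw [interior_Icc] at ht
    rw [(hg t (hb₀.trans ht.1)).deriv]
    exact hsub ⟨(le_max_left _ _).trans_lt ht.1, ht.2⟩
  have h₁ := hanti (left_mem_Icc.2 hb.le) (right_mem_Icc.2 hb.le) hb
  linarith [hlt _ ⟨hb₀.le, hb⟩]

/-- A function with positive derivative at `τ` exceeds its value there immediately afterwards. -/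
lemma eventually_gt_of_hasDerivAt_pos {g : ℝ → ℝ} {g' τ : ℝ} (hg : HasDerivAt g g' τ)
    (hpos : 0 < g') : ∀ᶠ t in 𝓝[>] τ, g τ < g t := by
  have hs := (hasDerivAt_iff_tendsto_slope_left_right.1 hg).2
  filter_upwards [hs.eventually_const_lt hpos, self_mem_nhdsWithin] with t ht htτ
  rw [slope_def_field] at ht
  have htτ' : 0 < t - τ := sub_pos.2 htτ
  linarith [(div_pos_iff_of_pos_right htτ').1 ht]

/-- At the first exit time of a solution from a sublevel set, the transversality condition forces
the defining function to increase strictly. -/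
lemma eventually_gt_of_first_exit {m : ℕ} {M : Set (EuclideanSpace ℝ (Fin m))}
    (hM : IsOpen M)
    {f : ℝ → EuclideanSpace ℝ (Fin m) → EuclideanSpace ℝ (Fin m) → EuclideanSpace ℝ (Fin m)}
    {F : EuclideanSpace ℝ (Fin m) → ℝ} (hF : ContDiffOn ℝ 4 F M) {c : ℝ}
    {x x' : ℝ → EuclideanSpace ℝ (Fin m)} (hx : IsSolOn M f x x' (Ici 0)) {τ : ℝ} (hτ : 0 < τ)
    (htrans : fderiv ℝ F (x τ) (x' τ) = 0 →
      0 < fderiv ℝ F (x τ) (f τ (x τ) (x' τ)) + fderiv ℝ (fderiv ℝ F) (x τ) (x' τ) (x' τ))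
    (hFτ : F (x τ) = c) (hlt : ∀ t ∈ Ico 0 τ, F (x t) < c) :
    ∀ᶠ t in 𝓝[>] τ, c < F (x t) := by
  have hFat : ∀ t > 0, ContDiffAt ℝ 4 F (x t) := fun t ht =>
    hF.contDiffAt (hM.mem_nhds (hx t ht.le).1)
  have hxd : ∀ t > 0, HasDerivAt x (x' t) t := fun t ht =>
    (hx t ht.le).2.1.hasDerivAt (Ici_mem_nhds ht)
  have hg : ∀ t > 0, HasDerivAt (fun t => F (x t)) (fderiv ℝ F (x t) (x' t)) t := fun t ht =>
    (((hFat t ht).differentiableAt (by norm_num)).hasFDerivAt).comp_hasDerivAt t (hxd t ht)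
  have hdF : HasFDerivAt (fderiv ℝ F) (fderiv ℝ (fderiv ℝ F) (x τ)) (x τ) :=
    (((hFat τ hτ).fderiv_right (m := 1) (by norm_num)).differentiableAt (by norm_num)).hasFDerivAt
  have hh := (hdF.comp_hasDerivAt τ (hxd τ hτ)).clm_apply
    ((hx τ hτ.le).2.2.hasDerivAt (Ici_mem_nhds hτ))
  have hpos := deriv_pos_of_first_hit hτ hg hh
    (fun h => by simpa [add_comm] using htrans h) hFτ hlt
  simpa [hFτ] using eventually_gt_of_hasDerivAt_pos (hg τ hτ) hpos

/-- Solutions of `ẍ = f(t, x, ẋ)` with initial velocity `v(y)` depend continuously on the initial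
point `y`, uniformly on compact time intervals. -/
lemma eventually_dist_lt_of_isSolOn {m : ℕ} {M D : Set (EuclideanSpace ℝ (Fin m))}
    (hM : IsOpen M) (hDM : D ⊆ M)
    {f : ℝ → EuclideanSpace ℝ (Fin m) → EuclideanSpace ℝ (Fin m) → EuclideanSpace ℝ (Fin m)}
    (hf : ContDiffOn ℝ 2
      (fun p : ℝ × EuclideanSpace ℝ (Fin m) × EuclideanSpace ℝ (Fin m) => f p.1 p.2.1 p.2.2)
      (Ici 0 ×ˢ M ×ˢ univ))
    {v : EuclideanSpace ℝ (Fin m) → EuclideanSpace ℝ (Fin m)} (hv : ContinuousOn v M)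
    {X X' : EuclideanSpace ℝ (Fin m) → ℝ → EuclideanSpace ℝ (Fin m)}
    (hX : ∀ y ∈ D, IsSolOn M f (X y) (X' y) (Ici 0) ∧ X y 0 = y ∧ X' y 0 = v y)
    {y₀ : EuclideanSpace ℝ (Fin m)} (hy₀ : y₀ ∈ D) (T : ℝ) {ε : ℝ} (hε : 0 < ε) :
    ∀ᶠ y in 𝓝[D] y₀, ∀ t ∈ Icc 0 T, dist (X y t) (X y₀ t) < ε := by
  let V : ℝ → EuclideanSpace ℝ (Fin m) × EuclideanSpace ℝ (Fin m) →
    EuclideanSpace ℝ (Fin m) × EuclideanSpace ℝ (Fin m) := fun t p => (p.2, f t p.1 p.2)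
  have hV : ContDiffOn ℝ 1 (fun p : ℝ × EuclideanSpace ℝ (Fin m) × EuclideanSpace ℝ (Fin m) =>
      V p.1 p.2) (Ici 0 ×ˢ (M ×ˢ univ)) :=
    contDiff_snd.snd.contDiffOn.prodMk (hf.of_le (by norm_num))
  have hsol : ∀ y ∈ D, ∀ t ∈ Ici (0 : ℝ),
      HasDerivWithinAt (fun t => (X y t, X' y t)) (V t (X y t, X' y t)) (Ici 0) t :=
    fun y hy t ht => ((hX y hy).1 t ht).2.1.prodMk ((hX y hy).1 t ht).2.2
  obtain ⟨δ, hδ, hdep⟩ := exists_dist_lt_of_dist_initial_lt (hM.prod isOpen_univ) hV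
    (hsol y₀ hy₀) (fun t ht => ⟨((hX y₀ hy₀).1 t ht).1, mem_univ _⟩) T hε
  have hinit : ContinuousWithinAt (fun y => (y, v y)) D y₀ :=
    continuousWithinAt_id.prodMk ((hv y₀ (hDM hy₀)).mono hDM)
  filter_upwards [hinit (ball_mem_nhds _ hδ), self_mem_nhdsWithin] with y hy hyD t ht
  refine lt_of_le_of_lt ?_ (hdep _ (hsol y hyD) ?_ t ht)
  · exact le_max_left _ _
  · simpa [(hX y hyD).2, (hX y₀ hy₀).2] using hy

/-- Lemma 2: the first exit time `τ(y)` of the solution starting at `y ∈ D_c` with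
velocity `v(y)` depends continuously on `y ∈ D_c`. -/
theorem exit_time_continuous_on_Dc {m : ℕ} (M : Set (EuclideanSpace ℝ (Fin m)))
    (hMopen : IsOpen M) (hMconn : IsConnected M)
    (f : ℝ → EuclideanSpace ℝ (Fin m) → EuclideanSpace ℝ (Fin m) → EuclideanSpace ℝ (Fin m))
    (hf : ContDiffOn ℝ 2
      (fun p : ℝ × EuclideanSpace ℝ (Fin m) × EuclideanSpace ℝ (Fin m) => f p.1 p.2.1 p.2.2)
      (Ici 0 ×ˢ M ×ˢ univ))
    (F : EuclideanSpace ℝ (Fin m) → ℝ) (hF : ContDiffOn ℝ 4 F M) (c : ℝ)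
    (Dc bDc : Set (EuclideanSpace ℝ (Fin m)))
    (hDc : Dc = {x ∈ M | F x < c}) (hbDc : bDc = {x ∈ M | F x = c})
    (h2 : IsCompact (closure Dc)) (h2' : closure Dc ⊆ M)
    -- transversality condition on the boundary
    (h3 : ∀ t ∈ Ici (0:ℝ), ∀ x ∈ bDc, ∀ ξ : EuclideanSpace ℝ (Fin m),
      fderiv ℝ F x ξ = 0 →
      0 < fderiv ℝ F x (f t x ξ) + fderiv ℝ (fderiv ℝ F) x ξ ξ)
    -- the continuous vector field of initial velocities
    (v : EuclideanSpace ℝ (Fin m) → EuclideanSpace ℝ (Fin m)) (hv : ContinuousOn v M)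
    -- the family of solutions `x(t, y)` with `x(0, y) = y`, `ẋ(0, y) = v(y)`
    (X X' : EuclideanSpace ℝ (Fin m) → ℝ → EuclideanSpace ℝ (Fin m))
    (hX : ∀ y ∈ Dc, IsSolOn M f (X y) (X' y) (Ici 0) ∧ X y 0 = y ∧ X' y 0 = v y)
    -- every solution leaves `D_c`; `τ y` is the first exit time
    (τ : EuclideanSpace ℝ (Fin m) → ℝ)
    (hτ : ∀ y ∈ Dc, 0 < τ y ∧ F (X y (τ y)) = c ∧ ∀ t ∈ Ico (0:ℝ) (τ y), X y t ∈ Dc) :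
    ContinuousOn τ Dc := by
  have hDM : Dc ⊆ M := subset_closure.trans h2'
  have hDopen : IsOpen Dc := by
    rw [hDc]
    exact hF.continuousOn.isOpen_inter_preimage hMopen isOpen_Iio
  intro y₀ hy₀
  obtain ⟨hτ₀, hFτ₀, hin₀⟩ := hτ y₀ hy₀
  have hsol₀ := (hX y₀ hy₀).1
  have hlt_c : ∀ x ∈ Dc, F x < c := fun x hx => by
    rw [hDc] at hx
    exact hx.2
  have hcont₀ : ContinuousOn (X y₀) (Ici 0) := fun t ht => (hsol₀ t ht).2.1.continuousWithinAt
  have hexit := eventually_gt_of_first_exit hMopen hF hsol₀ hτ₀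
    (h3 _ hτ₀.le _ (by rw [hbDc]; exact ⟨(hsol₀ _ hτ₀.le).1, hFτ₀⟩) _) hFτ₀
    fun t ht => hlt_c _ (hin₀ t ht)
  refine tendsto_order.2 ⟨fun a ha => ?_, fun b hb => ?_⟩
  · have hK : IsCompact (X y₀ '' Icc 0 a) :=
      isCompact_Icc.image_of_continuousOn (hcont₀.mono Icc_subset_Ici_self)
    obtain ⟨ε, hε, hsub⟩ := hK.exists_thickening_subset_open hDopen
      (image_subset_iff.2 fun t ht => hin₀ t ⟨ht.1, ht.2.trans_lt ha⟩)
    filter_upwards [eventually_dist_lt_of_isSolOn hMopen hDM hf hv hX hy₀ a hε,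
      self_mem_nhdsWithin] with y hy hyD
    obtain ⟨hτy, hFτy, -⟩ := hτ y hyD
    by_contra! hle
    have hmem : X y (τ y) ∈ Dc :=
      hsub (mem_thickening_iff.2 ⟨_, mem_image_of_mem _ ⟨hτy.le, hle⟩, hy _ ⟨hτy.le, hle⟩⟩)
    exact (hlt_c _ hmem).ne hFτy
  · obtain ⟨t, hct, htb, htτ⟩ := (hexit.and ((eventually_lt_nhds hb).filter_mono
      nhdsWithin_le_nhds |>.and self_mem_nhdsWithin)).exists
    have ht₀ : 0 ≤ t := hτ₀.le.trans (le_of_lt htτ)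
    obtain ⟨ε, hε, hsub⟩ := isOpen_iff.1
      (hF.continuousOn.isOpen_inter_preimage hMopen isOpen_Ioi) _ ⟨(hsol₀ t ht₀).1, hct⟩
    filter_upwards [eventually_dist_lt_of_isSolOn hMopen hDM hf hv hX hy₀ t hε,
      self_mem_nhdsWithin] with y hy hyD
    refine lt_of_le_of_lt ?_ htb
    by_contra! hlt
    exact lt_asymm (hlt_c _ ((hτ y hyD).2.2 t ⟨ht₀, hlt⟩)) (hsub (hy t ⟨ht₀, le_rfl⟩)).2
end
end
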